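/- Let 𝒞 be a set of TC statements and let Q^max be a max-query with core Q(x̄, y) (y the aggregation variable, the last distinguished variable). Then 𝒞 entails Compl(Q^max) if and only if Q is dominated by the unfolded query Q^𝒞. -/

import Mathlib

/-!
Framework for completeness reasoning over relational databases
(Razniewski, "Query-driven Data Completeness Management").

The domain of constants is the dense linearly ordered set `ℚ`.
-/

/-- A relational signature: relation symbols with arities. -/
structure Sig where
  Rel : Type
  arity : Rel → ℕ

/-- A (ground) fact over a signature `σ`. -/
structure DFact (σ : Sig) where
  rel : σ.Rel
  args : Fin (σ.arity rel) → ℚ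

/-- A database: a set of facts (database *instances* are the finite ones). -/
abbrev DB (σ : Sig) := Set (DFact σ)

/-- Terms over a variable type `V`: variables or constants. -/
inductive Term (V : Type)
  | var : V → Term V
  | const : ℚ → Term V

/-- Evaluation of a term under a valuation. -/
def Term.eval {V : Type} (v : V → ℚ) : Term V → ℚ
  | .var x => v x
  | .const c => c

/-- A relational atom. -/
structure RAtom (σ : Sig) (V : Type) where
  rel : σ.Rel
  args : Fin (σ.arity rel) → Term V

/-- Instantiating a relational atom by a valuation yields a fact. -/
def RAtom.inst {σ : Sig} {V : Type} (A : RAtom σ V) (v : V → ℚ) : DFact σ :=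
  ⟨A.rel, fun i => (A.args i).eval v⟩

/-- A variable occurs in a relational atom. -/
def RAtom.hasVar {σ : Sig} {V : Type} (A : RAtom σ V) (x : V) : Prop :=
  ∃ i, A.args i = Term.var x

/-- Comparison operators `=`, `<`, `≤`. -/
inductive CmpOp
  | eq
  | lt
  | le

def CmpOp.holds : CmpOp → ℚ → ℚ → Prop
  | .eq, a, b => a = b
  | .lt, a, b => a < b
  | .le, a, b => a ≤ b

/-- A comparison atom between two terms. -/
structure CAtom (V : Type) where
  op : CmpOp
  lhs : Term V
  rhs : Term V

def CAtom.holds {V : Type} (c : CAtom V) (v : V → ℚ) : Prop :=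
  c.op.holds (c.lhs.eval v) (c.rhs.eval v)

/-- A condition: a set of relational atoms and a set of comparison atoms. -/
structure Condition (σ : Sig) (V : Type) where
  ratoms : Set (RAtom σ V)
  catoms : Set (CAtom V)

/-- The condition is a *finite* set of atoms. -/
def Condition.IsFinite {σ : Sig} {V : Type} (G : Condition σ V) : Prop :=
  G.ratoms.Finite ∧ G.catoms.Finite

/-- A valuation satisfies a condition over a database: all instantiated relational
atoms belong to the database and all comparisons hold in `ℚ`. -/
def Condition.sat {σ : Sig} {V : Type} (G : Condition σ V) (v : V → ℚ) (D : DB σ) : Prop :=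
  (∀ A ∈ G.ratoms, A.inst v ∈ D) ∧ (∀ c ∈ G.catoms, c.holds v)

/-- A conjunctive query `Q(x̄) :- B` with head arity `k`; its variables are `Fin nvars`. -/
structure CQ (σ : Sig) (k : ℕ) where
  nvars : ℕ
  head : Fin k → Term (Fin nvars)
  body : Condition σ (Fin nvars)

/-- Safety: every variable occurs in some relational atom of the body. -/
def CQ.safe {σ : Sig} {k : ℕ} (Q : CQ σ k) : Prop :=
  ∀ x : Fin Q.nvars, ∃ A ∈ Q.body.ratoms, A.hasVar x

/-- The output tuple of a valuation. -/
def CQ.out {σ : Sig} {k : ℕ} (Q : CQ σ k) (v : Fin Q.nvars → ℚ) : Fin k → ℚ :=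
  fun i => (Q.head i).eval v

/-- Set semantics: `Q^s(D)`. -/
def CQ.evalS {σ : Sig} {k : ℕ} (Q : CQ σ k) (D : DB σ) : Set (Fin k → ℚ) :=
  { t | ∃ v, Q.body.sat v D ∧ Q.out v = t }

/-- Bag semantics: the multiplicity of an answer tuple `t` in `Q^b(D)`, i.e. the
number of satisfying valuations yielding `t`. -/
noncomputable def CQ.mult {σ : Sig} {k : ℕ} (Q : CQ σ k) (D : DB σ) (t : Fin k → ℚ) : ℕ :=
  Set.ncard { v : Fin Q.nvars → ℚ | Q.body.sat v D ∧ Q.out v = t }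

/-- Equality of the bags `Q^b(D₁)` and `Q^b(D₂)`. -/
def CQ.bagEq {σ : Sig} {k : ℕ} (Q : CQ σ k) (D₁ D₂ : DB σ) : Prop :=
  ∀ t, Q.mult D₁ t = Q.mult D₂ t

/-- An incomplete database `𝒟 = (D̂, Ď)`: available ⊆ ideal, both finite. -/
structure IncDB (σ : Sig) where
  ideal : DB σ
  avail : DB σ
  sub : avail ⊆ ideal
  fin : ideal.Finite

/-- `𝒟 ⊨ Compl^s(Q)`. -/
def IncDB.complS {σ : Sig} {k : ℕ} (𝒟 : IncDB σ) (Q : CQ σ k) : Prop :=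
  Q.evalS 𝒟.avail = Q.evalS 𝒟.ideal

/-- `𝒟 ⊨ Compl^b(Q)`. -/
def IncDB.complB {σ : Sig} {k : ℕ} (𝒟 : IncDB σ) (Q : CQ σ k) : Prop :=
  Q.bagEq 𝒟.avail 𝒟.ideal

/-- A table completeness statement `Compl(R(t̄); G)` for the relation `R`. -/
structure TCStmt (σ : Sig) (R : σ.Rel) where
  nvars : ℕ
  args : Fin (σ.arity R) → Term (Fin nvars)
  cond : Condition σ (Fin nvars)

/-- The instantiated head fact `R(v t̄)` of a TCS statement. -/
def TCStmt.headFact {σ : Sig} {R : σ.Rel} (C : TCStmt σ R) (v : Fin C.nvars → ℚ) : DFact σ :=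
  ⟨R, fun i => (C.args i).eval v⟩

/-- Safety of a TCS statement: every variable occurs in a relational atom of `{R(t̄)} ∪ G`. -/
def TCStmt.safe {σ : Sig} {R : σ.Rel} (C : TCStmt σ R) : Prop :=
  ∀ x : Fin C.nvars, (∃ i, C.args i = Term.var x) ∨ ∃ A ∈ C.cond.ratoms, A.hasVar x

/-- `𝒟 ⊨ Compl(R(t̄); G)`: every fact `R(d̄)` with `d̄ ∈ Q_C^s(D̂)` belongs to `Ď`. -/
def TCStmt.sats {σ : Sig} {R : σ.Rel} (C : TCStmt σ R) (𝒟 : IncDB σ) : Prop :=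
  ∀ v, C.headFact v ∈ 𝒟.ideal → C.cond.sat v 𝒟.ideal → C.headFact v ∈ 𝒟.avail

/-- A TCS statement packaged together with its relation symbol. -/
structure TCS (σ : Sig) where
  rel : σ.Rel
  stmt : TCStmt σ rel

def TCS.sats {σ : Sig} (C : TCS σ) (𝒟 : IncDB σ) : Prop := C.stmt.sats 𝒟
def TCS.safe {σ : Sig} (C : TCS σ) : Prop := C.stmt.safe
/-- A relational TCS statement: no comparisons in the condition. -/
def TCS.relational {σ : Sig} (C : TCS σ) : Prop := C.stmt.cond.catoms = ∅
def TCS.isFinite {σ : Sig} (C : TCS σ) : Prop := C.stmt.cond.IsFinite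

/-- Satisfaction of all canonical completeness statements `𝒞_Q` of `Q`:
for each relational atom `Aᵢ` of the body, the statement
`Cᵢ = Compl(Aᵢ; {A₁,…,Aₙ} \ {Aᵢ} ∪ M)` is satisfied, i.e. every valuation that
satisfies the whole body over the ideal database has its instance of `Aᵢ` in the
available database. -/
def CQ.canonSat {σ : Sig} {k : ℕ} (Q : CQ σ k) (𝒟 : IncDB σ) : Prop :=
  ∀ A ∈ Q.body.ratoms, ∀ v, Q.body.sat v 𝒟.ideal → A.inst v ∈ 𝒟.avail

/-- Projection-free: every variable occurs in the head. -/
def CQ.projFree {σ : Sig} {k : ℕ} (Q : CQ σ k) : Prop :=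
  ∀ x : Fin Q.nvars, ∃ i, Q.head i = Term.var x

/-- The query obtained from `Q` by removing the relational atom `A` from its body. -/
def CQ.drop {σ : Sig} {k : ℕ} (Q : CQ σ k) (A : RAtom σ (Fin Q.nvars)) : CQ σ k :=
  ⟨Q.nvars, Q.head, ⟨Q.body.ratoms \ {A}, Q.body.catoms⟩⟩

/-- Set-equivalence of two queries of the same arity. -/
def CQ.setEquiv {σ : Sig} {k : ℕ} (Q Q' : CQ σ k) : Prop :=
  ∀ D : DB σ, D.Finite → Q.evalS D = Q'.evalS D

/-- Minimality: no relational atom can be removed without losing set-equivalence. -/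
def CQ.minimal {σ : Sig} {k : ℕ} (Q : CQ σ k) : Prop :=
  ∀ A ∈ Q.body.ratoms, ¬ Q.setEquiv (Q.drop A)

/-- A valuation satisfies the unfolding `Q^𝒞` of `Q` w.r.t. the TCS statements `𝒞`
over `D`: the comparisons of `Q` hold and every body atom is matched in `D` by the
head of some statement of `𝒞` whose condition is satisfied (the variables of the
statements being renamed apart from `Q` and from each other). -/
def unfoldSat {σ : Sig} {k : ℕ} (Q : CQ σ k) (𝒞 : Set (TCS σ))
    (v : Fin Q.nvars → ℚ) (D : DB σ) : Prop :=
  (∀ c ∈ Q.body.catoms, c.holds v) ∧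
  ∀ A ∈ Q.body.ratoms, A.inst v ∈ D ∧
    ∃ C ∈ 𝒞, ∃ w : Fin C.stmt.nvars → ℚ, C.stmt.cond.sat w D ∧ C.stmt.headFact w = A.inst v

/-- The set-semantics answer `(Q^𝒞)^s(D)` of the unfolded query. -/
def unfoldEvalS {σ : Sig} {k : ℕ} (Q : CQ σ k) (𝒞 : Set (TCS σ)) (D : DB σ) :
    Set (Fin k → ℚ) :=
  { t | ∃ v, unfoldSat Q 𝒞 v D ∧ Q.out v = t }

/-- `T_C(D) = { R(d̄) : d̄ ∈ Q_C^s(D) }`. -/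
def TCS.T {σ : Sig} (C : TCS σ) (D : DB σ) : Set (DFact σ) :=
  { f | ∃ v, C.stmt.headFact v ∈ D ∧ C.stmt.cond.sat v D ∧ f = C.stmt.headFact v }

/-- `T_𝒞(D) = ⋃_{C ∈ 𝒞} T_C(D)`. -/
def TSet {σ : Sig} (𝒞 : Set (TCS σ)) (D : DB σ) : Set (DFact σ) :=
  ⋃ C ∈ 𝒞, C.T D

/-- Constants occurring in a term. -/
def Term.consts {V : Type} : Term V → Set ℚ
  | .var _ => ∅
  | .const c => {c}

def RAtom.consts {σ : Sig} {V : Type} (A : RAtom σ V) : Set ℚ :=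
  ⋃ i, (A.args i).consts

def CAtom.consts {V : Type} (c : CAtom V) : Set ℚ :=
  c.lhs.consts ∪ c.rhs.consts

def Condition.consts {σ : Sig} {V : Type} (G : Condition σ V) : Set ℚ :=
  (⋃ A ∈ G.ratoms, A.consts) ∪ ⋃ c ∈ G.catoms, c.consts

def CQ.consts {σ : Sig} {k : ℕ} (Q : CQ σ k) : Set ℚ :=
  (⋃ i, (Q.head i).consts) ∪ Q.body.consts

def TCS.consts {σ : Sig} (C : TCS σ) : Set ℚ :=
  (⋃ i, (C.stmt.args i).consts) ∪ C.stmt.cond.consts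

/-- The answer of the max-query `Q^max` over `D`: pairs `(d̄, m)` such that `(d̄, m)`
is an answer of the core and `m` is the maximum of all `d` with `(d̄, d) ∈ Q^s(D)`. -/
def CQ.maxEval {σ : Sig} {k : ℕ} (Q : CQ σ (k + 1)) (D : DB σ) : Set ((Fin k → ℚ) × ℚ) :=
  { p | Fin.snoc p.1 p.2 ∈ Q.evalS D ∧
        ∀ d : ℚ, (Fin.snoc p.1 d : Fin (k + 1) → ℚ) ∈ Q.evalS D → d ≤ p.2 }

/-- `𝒟 ⊨ Compl(Q^max)`. -/
def IncDB.complMax {σ : Sig} {k : ℕ} (𝒟 : IncDB σ) (Q : CQ σ (k + 1)) : Prop :=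
  Q.maxEval 𝒟.avail = Q.maxEval 𝒟.ideal

theorem TSet_sub {σ : Sig} (𝒞 : Set (TCS σ)) (D : DB σ) : TSet 𝒞 D ⊆ D := by
  intro f hf
  simp only [TSet, Set.mem_iUnion] at hf
  obtain ⟨C, hC, v, h1, h2, rfl⟩ := hf
  exact h1

theorem unfoldEvalS_eq {σ : Sig} {k : ℕ} (Q : CQ σ k) (𝒞 : Set (TCS σ)) (D : DB σ) :
    unfoldEvalS Q 𝒞 D = Q.evalS (TSet 𝒞 D) := by
  ext t
  constructor
  · rintro ⟨v, ⟨hc, hr⟩, ht⟩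
    refine ⟨v, ⟨fun A hA => ?_, hc⟩, ht⟩
    obtain ⟨h1, C, hC, w, hw, he⟩ := hr A hA
    simp only [TSet, Set.mem_iUnion]
    exact ⟨C, hC, w, by rw [he]; exact h1, hw, he.symm⟩
  · rintro ⟨v, ⟨hr, hc⟩, ht⟩
    refine ⟨v, ⟨hc, fun A hA => ?_⟩, ht⟩
    refine ⟨TSet_sub 𝒞 D (hr A hA), ?_⟩
    have h := hr A hA
    simp only [TSet, Set.mem_iUnion] at h
    obtain ⟨C, hC, w, h1, h2, h3⟩ := h
    exact ⟨C, hC, w, h2, h3.symm⟩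

theorem evalS_mono {σ : Sig} {k : ℕ} (Q : CQ σ k) {D E : DB σ} (h : D ⊆ E) :
    Q.evalS D ⊆ Q.evalS E := by
  rintro t ⟨v, ⟨hr, hc⟩, ht⟩
  exact ⟨v, ⟨fun A hA => h (hr A hA), hc⟩, ht⟩

theorem evalS_finite {σ : Sig} {k : ℕ} (Q : CQ σ k) (hs : Q.safe) {D : DB σ} (hD : D.Finite) :
    (Q.evalS D).Finite := by
  have hS : (⋃ f ∈ D, Set.range f.args).Finite := hD.biUnion fun f _ => Set.finite_range _
  have hV : {v : Fin Q.nvars → ℚ | Q.body.sat v D}.Finite := by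
    refine (Set.Finite.pi' (fun _ : Fin Q.nvars => hS)).subset ?_
    intro v hv x
    obtain ⟨A, hA, i, hi⟩ := hs x
    have h := hv.1 A hA
    simp only [Set.mem_iUnion]
    refine ⟨_, h, i, ?_⟩
    simp [RAtom.inst, hi, Term.eval]
  refine (hV.image Q.out).subset ?_
  rintro t ⟨v, hv, ht⟩
  exact ⟨v, hv, ht⟩

/-- `𝒞 ⊨ Compl(Q^max)` iff the core `Q` is dominated by the
unfolded query `Q^𝒞`. -/
theorem max_query_completeness_iff_dominance
    (σ : Sig) (k : ℕ) (Q : CQ σ (k + 1))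
    (hsafe : Q.safe) (hfin : Q.body.IsFinite)
    (𝒞 : Set (TCS σ))
    (hCsafe : ∀ C ∈ 𝒞, C.safe) (hCfin : ∀ C ∈ 𝒞, C.isFinite) :
    (∀ 𝒟 : IncDB σ, (∀ C ∈ 𝒞, C.sats 𝒟) → 𝒟.complMax Q) ↔
      (∀ D : DB σ, D.Finite → ∀ t ∈ Q.evalS D, ∃ t' ∈ unfoldEvalS Q 𝒞 D,
        (∀ i : Fin k, t' i.castSucc = t i.castSucc) ∧
        t (Fin.last k) ≤ t' (Fin.last k)) := by
  simp only [unfoldEvalS_eq]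
  constructor
  · intro h D hD t ht
    have hcompl := h ⟨D, TSet 𝒞 D, TSet_sub 𝒞 D, hD⟩ (by
      intro C hC v h1 h2
      simp only [TSet, Set.mem_iUnion]
      exact ⟨C, hC, v, h1, h2, rfl⟩)
    have hfinS : {d : ℚ | (Fin.snoc (Fin.init t) d : Fin (k + 1) → ℚ) ∈ Q.evalS D}.Finite := by
      refine ((evalS_finite Q hsafe hD).image (fun t => t (Fin.last k))).subset ?_
      intro d hd
      exact ⟨_, hd, by simp⟩
    have ht0 : t (Fin.last k) ∈
        {d : ℚ | (Fin.snoc (Fin.init t) d : Fin (k + 1) → ℚ) ∈ Q.evalS D} := by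
      simpa [Fin.snoc_init_self] using ht
    obtain ⟨m, hm, hmax⟩ := Set.exists_max_image _ id hfinS ⟨_, ht0⟩
    have hp : ((Fin.init t : Fin k → ℚ), m) ∈ Q.maxEval D := ⟨hm, fun d hd => hmax d hd⟩
    have hp2 : ((Fin.init t : Fin k → ℚ), m) ∈ Q.maxEval (TSet 𝒞 D) := by
      have e : Q.maxEval (TSet 𝒞 D) = Q.maxEval D := hcompl
      rw [e]; exact hp
    refine ⟨_, hp2.1, fun i => ?_, ?_⟩
    · simp [Fin.init]
    · simpa using hmax _ ht0
  · intro h 𝒟 hsat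
    have hT : TSet 𝒞 𝒟.ideal ⊆ 𝒟.avail := by
      intro f hf
      simp only [TSet, Set.mem_iUnion] at hf
      obtain ⟨C, hC, v, h1, h2, rfl⟩ := hf
      exact hsat C hC v h1 h2
    have key : ∀ (x : Fin k → ℚ) (d : ℚ),
        (Fin.snoc x d : Fin (k + 1) → ℚ) ∈ Q.evalS 𝒟.ideal →
        ∃ d', d ≤ d' ∧ (Fin.snoc x d' : Fin (k + 1) → ℚ) ∈ Q.evalS 𝒟.avail := by
      intro x d hd
      obtain ⟨t', ht', hx, hl⟩ := h 𝒟.ideal 𝒟.fin _ hd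
      refine ⟨t' (Fin.last k), by simpa using hl, ?_⟩
      have e : (Fin.snoc x (t' (Fin.last k)) : Fin (k + 1) → ℚ) = t' := by
        have : x = Fin.init t' := by
          funext i
          simpa [Fin.init] using (hx i).symm
        rw [this, Fin.snoc_init_self]
      rw [e]
      exact evalS_mono Q hT ht'
    have hsub := evalS_mono Q 𝒟.sub
    unfold IncDB.complMax
    ext ⟨x, m⟩
    constructor
    · rintro ⟨h1, h2⟩
      refine ⟨hsub h1, fun d hd => ?_⟩
      obtain ⟨d', hle, hd'⟩ := key x d hd
      exact hle.trans (h2 d' hd')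
    · rintro ⟨h1, h2⟩
      refine ⟨?_, fun d hd => h2 d (hsub hd)⟩
      obtain ⟨d', hle, hd'⟩ := key x m h1
      have e : d' = m := le_antisymm (h2 d' (hsub hd')) hle
      rw [e] at hd'
      exact hd'
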